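/- arXiv:1906.10051 — 2 statements merged into one kernel-verified Lean document; each statement's English description precedes it below -/
import Mathlib

section
/- Let E be a finite-dimensional real inner product space, let A : E → E be a self-adjoint linear map, and let u : E → ℝ be such that u is convex and Hu ≤ A (i.e. x ↦ u(x) − (1/2)⟨Ax, x⟩ is concave). Then u is differentiable and for all x, x', y ∈ E, |⟨∇u(x) − ∇u(x'), y⟩| ≤ ⟨A(x−x'), x−x'⟩^{1/2} ⟨Ay, y⟩^{1/2}; in particular, ‖∇u(x) − ∇u(x')‖ ≤ ‖A‖ ‖x − x'‖, where ‖A‖ is the operator norm. -/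
open Set
open scoped RealInnerProductSpace

theorem ConvexOn.exists_subgradient {E : Type*} [NormedAddCommGroup E] [NormedSpace ℝ E]
    {f : E → ℝ} (hf : ConvexOn ℝ univ f) (hfc : Continuous f) (x : E) :
    ∃ p : StrongDual ℝ E, ∀ z, f x + p z ≤ f (x + z) := by
  have hopen : IsOpen {q : E × ℝ | q.1 ∈ univ ∧ f q.1 < q.2} := by
    simpa using isOpen_lt (hfc.comp continuous_fst) continuous_snd
  obtain ⟨L, hL⟩ := geometric_hahn_banach_point_open (x := (x, f x))
    hf.convex_strict_epigraph hopen (by simp)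
  have hsplit (y : E) (t : ℝ) : L (y, t) = L (y, 0) + t * L (0, 1) := by
    rw [← smul_eq_mul, ← map_smul, ← map_add]
    simp
  have hlt (y : E) (t : ℝ) (h : f y < t) :
      L (x, 0) + f x * L (0, 1) < L (y, 0) + t * L (0, 1) := by
    rw [← hsplit, ← hsplit]
    exact hL (y, t) ⟨mem_univ _, h⟩
  have hc : 0 < L (0, 1) := by linarith [hlt x (f x + 1) (by linarith)]
  refine ⟨-(L (0, 1))⁻¹ • L.comp (ContinuousLinearMap.inl ℝ E ℝ), fun z => ?_⟩
  refine le_of_forall_pos_le_add fun ε hε => ?_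
  have h := hlt (x + z) (f (x + z) + ε) (by linarith)
  have hadd : L (x + z, 0) = L (x, 0) + L (z, 0) := by
    rw [← map_add]
    simp
  have hz : L (0, 1) * ((L (0, 1))⁻¹ * L (z, 0)) = L (z, 0) := mul_inv_cancel_left₀ hc.ne' _
  suffices f x + -((L (0, 1))⁻¹ * L (z, 0)) ≤ f (x + z) + ε by simpa using this
  refine le_of_mul_le_mul_left ?_ hc
  linarith

section QuadraticBounds

variable {E : Type*} [NormedAddCommGroup E] [InnerProductSpace ℝ E] {A : E →L[ℝ] E} {u : E → ℝ}

theorem ConvexOn.exists_quadratic_bounds [FiniteDimensional ℝ E]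
    (hA : ∀ x y : E, ⟪A x, y⟫ = ⟪x, A y⟫) (hconv : ConvexOn ℝ univ u)
    (hconc : ConcaveOn ℝ univ (fun x => u x - (1 / 2) * ⟪A x, x⟫)) (x : E) :
    ∃ p : StrongDual ℝ E, ∀ z,
      u x + p z ≤ u (x + z) ∧ u (x + z) ≤ u x + p z + (1 / 2) * ⟪A z, z⟫ := by
  have hcont : Continuous u := continuousOn_univ.1 (hconv.continuousOn isOpen_univ)
  obtain ⟨p, hp⟩ := hconv.exists_subgradient hcont x
  obtain ⟨m, hm⟩ := hconc.neg.exists_subgradient (by fun_prop) x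
  have hupper (z : E) : u (x + z) ≤ u x + (⟪A x, z⟫ - m z) + (1 / 2) * ⟪A z, z⟫ := by
    have h := hm z
    simp only [Pi.neg_apply, map_add, inner_add_left, inner_add_right] at h
    have hsymm : ⟪A z, x⟫ = ⟪A x, z⟫ := by rw [hA, real_inner_comm]
    linarith
  have heq (z : E) : p z = ⟪A x, z⟫ - m z := by
    have h := discrim_le_zero (a := (1 / 2) * ⟪A z, z⟫) (b := ⟪A x, z⟫ - m z - p z) (c := 0)
      fun t => by
        have h₁ := hp (t • z)
        have h₂ := hupper (t • z)
        simp only [map_smul, inner_smul_left, inner_smul_right, smul_eq_mul,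
          conj_trivial] at h₁ h₂
        linarith
    rw [discrim, mul_zero, sub_zero] at h
    linarith [pow_eq_zero_iff (two_ne_zero) |>.1 (le_antisymm h (sq_nonneg _))]
  exact ⟨p, fun z => ⟨hp z, by rw [heq]; exact hupper z⟩⟩

theorem hasFDerivAt_of_quadratic_bounds {x : E} {p : StrongDual ℝ E}
    (h : ∀ z, u x + p z ≤ u (x + z) ∧ u (x + z) ≤ u x + p z + (1 / 2) * ⟪A z, z⟫) :
    HasFDerivAt u p x := by
  rw [hasFDerivAt_iff_isLittleO_nhds_zero]
  refine (Asymptotics.IsBigO.of_bound (‖A‖ / 2) (.of_forall fun z => ?_)).trans_isLittleO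
    (Asymptotics.isLittleO_norm_pow_id one_lt_two)
  obtain ⟨h₁, h₂⟩ := h z
  have h₃ : ⟪A z, z⟫ ≤ ‖A‖ * ‖z‖ * ‖z‖ := (real_inner_le_norm _ _).trans <|
    mul_le_mul_of_nonneg_right (A.le_opNorm z) (norm_nonneg z)
  rw [Real.norm_of_nonneg (by linarith), Real.norm_of_nonneg (by positivity)]
  linarith

theorem sq_sub_apply_le_of_quadratic_bounds {p : E → StrongDual ℝ E}
    (h : ∀ x z, u x + p x z ≤ u (x + z) ∧
      u (x + z) ≤ u x + p x z + (1 / 2) * ⟪A z, z⟫) (x x' y : E) :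
    (p x y - p x' y) ^ 2 ≤ ⟪A (x - x'), x - x'⟫ * ⟪A y, y⟫ := by
  have hd := discrim_le_zero (a := ⟪A y, y⟫) (b := -(2 * (p x y - p x' y)))
    (c := ⟪A (x - x'), x - x'⟫) fun t => by
      have h₁ := (h x' (t • y)).2
      have h₂ := (h x (x' - x + t • y)).1
      have h₃ := (h x (-(t • y))).2
      have h₄ := (h x' (x - x' - t • y)).1
      have h₅ := (h x (x' - x)).2
      have h₆ := (h x' (x - x')).2
      rw [show x + (x' - x + t • y) = x' + t • y by abel] at h₂
      rw [show x' + (x - x' - t • y) = x + -(t • y) by abel] at h₄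
      rw [add_sub_cancel, ← neg_sub x x', map_neg A, inner_neg_neg] at h₅
      rw [add_sub_cancel] at h₆
      simp only [map_add, map_sub, map_neg, map_smul, inner_smul_left, inner_smul_right,
        inner_neg_neg, smul_eq_mul, conj_trivial] at h₁ h₂ h₃ h₄ h₅ h₆ ⊢
      linarith
  rw [discrim] at hd
  linarith

end QuadraticBounds

/-- if `u` is convex and `Hu ≤ A`, then `u` is differentiable and its gradient
satisfies a Cauchy–Schwarz type bound in terms of `A`, in particular it is `‖A‖`-Lipschitz. -/
theorem stmt1 {E : Type*} [NormedAddCommGroup E] [InnerProductSpace ℝ E]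
    [FiniteDimensional ℝ E]
    (A : E →L[ℝ] E)
    (hA : ∀ x y : E, ⟪A x, y⟫ = ⟪x, A y⟫)
    (u : E → ℝ)
    (hconv : ConvexOn ℝ univ u)
    (hconc : ConcaveOn ℝ univ (fun x => u x - (1 / 2) * ⟪A x, x⟫)) :
    Differentiable ℝ u ∧
    (∀ x x' y : E,
      |⟪gradient u x - gradient u x', y⟫| ≤
        Real.sqrt ⟪A (x - x'), x - x'⟫ * Real.sqrt ⟪A y, y⟫) ∧
    (∀ x x' : E, ‖gradient u x - gradient u x'‖ ≤ ‖A‖ * ‖x - x'‖) := by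
  choose p hp using hconv.exists_quadratic_bounds hA hconc
  have hderiv (x : E) : HasFDerivAt u (p x) x := hasFDerivAt_of_quadratic_bounds (hp x)
  have hpos (z : E) : 0 ≤ ⟪A z, z⟫ := by linarith [hp 0 z]
  have hbound (x x' y : E) : |⟪gradient u x - gradient u x', y⟫| ≤
      Real.sqrt ⟪A (x - x'), x - x'⟫ * Real.sqrt ⟪A y, y⟫ := by
    rw [← Real.sqrt_mul (hpos _), inner_sub_left, inner_gradient_left, inner_gradient_left,
      (hderiv x).fderiv, (hderiv x').fderiv]
    exact Real.abs_le_sqrt (sq_sub_apply_le_of_quadratic_bounds hp x x' y)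
  have hsqrt (z : E) : Real.sqrt ⟪A z, z⟫ ≤ Real.sqrt ‖A‖ * ‖z‖ := by
    rw [← Real.sqrt_sq (norm_nonneg z), ← Real.sqrt_mul (norm_nonneg A)]
    refine Real.sqrt_le_sqrt ((real_inner_le_norm _ _).trans ?_)
    rw [sq, ← mul_assoc]
    exact mul_le_mul_of_nonneg_right (A.le_opNorm z) (norm_nonneg z)
  refine ⟨fun x => (hderiv x).differentiableAt, hbound, fun x x' => ?_⟩
  set d := gradient u x - gradient u x' with hd
  obtain h0 | h0 := (norm_nonneg d).eq_or_lt
  · rw [← h0]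
    positivity
  refine le_of_mul_le_mul_right ?_ h0
  calc ‖d‖ * ‖d‖ = ⟪d, d⟫ := (real_inner_self_eq_norm_mul_norm d).symm
    _ ≤ Real.sqrt ⟪A (x - x'), x - x'⟫ * Real.sqrt ⟪A d, d⟫ :=
      (le_abs_self _).trans (hbound x x' d)
    _ ≤ (Real.sqrt ‖A‖ * ‖x - x'‖) * (Real.sqrt ‖A‖ * ‖d‖) := by
      gcongr <;> exact hsqrt _
    _ = (Real.sqrt ‖A‖ * Real.sqrt ‖A‖) * ‖x - x'‖ * ‖d‖ := by ring
    _ = ‖A‖ * ‖x - x'‖ * ‖d‖ := by rw [Real.mul_self_sqrt (norm_nonneg A)]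
end

section
/- Let E, F, and H be finite-dimensional real inner product spaces, let 0 < c ≤ C, and let V : E × F → ℝ satisfy c ≤ HV ≤ C. Let f : E × F → H be Lipschitz with constant L with respect to the product norm ‖(x, y)‖ = (‖x‖² + ‖y‖²)^{1/2}. Define g : F → H by g(y) = (∫_E f(x, y) e^{−V(x,y)} dx) / (∫_E e^{−V(x,y)} dx). Then g is well-defined and Lipschitz with constant (1 + C/c) L. -/
open Set MeasureTheory

open scoped ENNReal

/-- The one-dimensional Brunn–Minkowski inequality at the midpoint, for compact sets. -/
lemma volume_add_volume_le_of_isCompact {A B C : Set ℝ} (hA : IsCompact A) (hB : IsCompact B)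
    (hA0 : A.Nonempty) (hB0 : B.Nonempty) (h : ∀ x d, x + d ∈ A → x - d ∈ B → x ∈ C) :
    volume A + volume B ≤ 2 * volume C := by
  obtain ⟨k, hk, hkA⟩ := hA.exists_isGreatest hA0
  obtain ⟨l, hl, hlB⟩ := hB.exists_isLeast hB0
  set A' : Set ℝ := (fun x => -l + x) ⁻¹' A with hA'
  set B' : Set ℝ := (fun x => -k + x) ⁻¹' B with hB'
  have hmB : MeasurableSet B' := hB.measurableSet.preimage (by fun_prop)
  have hAB : volume (A' ∩ B') = 0 := by
    refine measure_mono_null (t := {k + l}) ?_ (by simp)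
    rintro z ⟨h1, h2⟩
    have h3 := hkA h1
    have h4 := hlB h2
    simp only [mem_singleton_iff]
    linarith
  have hsub : A' ∪ B' ⊆ (fun x => (1 / 2 : ℝ) * x) ⁻¹' C := by
    rintro z (h1 | h1)
    · refine h _ (-l + z / 2) ?_ ?_
      · have : 1 / 2 * z + (-l + z / 2) = -l + z := by ring
        exact this ▸ h1
      · convert hl using 1; ring
    · refine h _ (k - z / 2) ?_ ?_
      · convert hk using 1; ring
      · have : 1 / 2 * z - (k - z / 2) = -k + z := by ring
        exact this ▸ h1
  calc volume A + volume B = volume A' + volume B' := by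
        rw [hA', hB', measure_preimage_add, measure_preimage_add]
    _ = volume (A' ∪ B') := by rw [← measure_union_add_inter A' hmB, hAB, add_zero]
    _ ≤ volume ((fun x => (1 / 2 : ℝ) * x) ⁻¹' C) := measure_mono hsub
    _ = 2 * volume C := by
        rw [Real.volume_preimage_mul_left (by norm_num)]
        norm_num

/-- The one-dimensional Brunn–Minkowski inequality at the midpoint. -/
lemma volume_add_volume_le {A B C : Set ℝ} (hA : MeasurableSet A) (hB : MeasurableSet B)
    (hA0 : A.Nonempty) (hB0 : B.Nonempty) (h : ∀ x d, x + d ∈ A → x - d ∈ B → x ∈ C) :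
    volume A + volume B ≤ 2 * volume C := by
  obtain ⟨a, ha⟩ := hA0
  obtain ⟨b, hb⟩ := hB0
  rw [hA.measure_eq_iSup_isCompact, hB.measure_eq_iSup_isCompact]
  simp only [iSup_and']
  refine ENNReal.biSup_add_biSup_le' (p := fun K => K ⊆ A ∧ IsCompact K)
    (q := fun K => K ⊆ B ∧ IsCompact K) ⟨∅, empty_subset _, isCompact_empty⟩
    ⟨∅, empty_subset _, isCompact_empty⟩ fun K hK L hL => ?_
  calc volume K + volume L ≤ volume (insert a K) + volume (insert b L) := by
        gcongr <;> exact subset_insert _ _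
    _ ≤ 2 * volume C :=
        volume_add_volume_le_of_isCompact (hK.2.insert a) (hL.2.insert b) ⟨a, by simp⟩
          ⟨b, by simp⟩ fun x d h1 h2 =>
            h x d (insert_subset ha hK.1 h1) (insert_subset hb hL.1 h2)

/-- A measure on an additive group satisfies the (midpoint) Prékopa–Leindler inequality. -/
def PrekopaLeindler {α : Type*} [AddGroup α] [MeasurableSpace α] (μ : Measure α) : Prop :=
  ∀ f g h : α → ℝ≥0∞, Measurable f → Measurable g → Measurable h →
    (∀ x d, f (x + d) * g (x - d) ≤ h x ^ 2) → (∫⁻ x, f x ∂μ) * (∫⁻ x, g x ∂μ) ≤ (∫⁻ x, h x ∂μ) ^ 2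

lemma ENNReal.mul_le_sq_of_add_le_two_mul {a b c : ℝ≥0∞} (h : a + b ≤ 2 * c) : a * b ≤ c ^ 2 := by
  induction c with
  | top => simp
  | coe c =>
    have hab : a + b ≠ ⊤ := ne_top_of_le_ne_top (by finiteness) h
    lift a to NNReal using fun h => hab (by simp [h])
    lift b to NNReal using fun h => hab (by simp [h])
    norm_cast at h ⊢
    have h' : (a : ℝ) + b ≤ 2 * c := by exact_mod_cast h
    have : (a : ℝ) * b ≤ c ^ 2 := by
      nlinarith [sq_nonneg ((a : ℝ) - b), a.2, b.2, c.2, add_nonneg a.2 b.2]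
    exact_mod_cast this

lemma lintegral_ofReal_mul_le_of_normalized {f g h : ℝ → ℝ} (hf : Measurable f) (hg : Measurable g)
    (hh : Measurable h) (hf0 : ∀ x, 0 ≤ f x) (hg0 : ∀ x, 0 ≤ g x) (hh0 : ∀ x, 0 ≤ h x)
    (hf1 : ∀ x, f x ≤ 1) (hg1 : ∀ x, g x ≤ 1) (hfs : ∀ s < 1, ∃ x, s < f x)
    (hgs : ∀ s < 1, ∃ x, s < g x) (hfgh : ∀ x d, f (x + d) * g (x - d) ≤ h x ^ 2) :
    (∫⁻ x, ENNReal.ofReal (f x)) * (∫⁻ x, ENNReal.ofReal (g x)) ≤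
      (∫⁻ x, ENNReal.ofReal (h x)) ^ 2 := by
  apply ENNReal.mul_le_sq_of_add_le_two_mul
  rw [lintegral_eq_lintegral_meas_lt _ (.of_forall hf0) hf.aemeasurable,
    lintegral_eq_lintegral_meas_lt _ (.of_forall hg0) hg.aemeasurable,
    lintegral_eq_lintegral_meas_lt _ (.of_forall hh0) hh.aemeasurable]
  have hmeas : ∀ u : ℝ → ℝ, Measurable fun t => volume {x | t < u x} := fun u =>
    Antitone.measurable fun s t hst => measure_mono fun x (hx : t < u x) => hst.trans_lt hx
  rw [← lintegral_add_left (hmeas f), ← lintegral_const_mul _ (hmeas h)]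
  refine setLIntegral_mono' measurableSet_Ioi fun s (hs : 0 < s) => ?_
  rcases lt_or_ge s 1 with hs1 | hs1
  · refine volume_add_volume_le (measurableSet_lt measurable_const hf)
      (measurableSet_lt measurable_const hg) (hfs s hs1) (hgs s hs1)
      fun x d (h1 : s < f _) (h2 : s < g _) => ?_
    have : s ^ 2 < h x ^ 2 := lt_of_lt_of_le (by nlinarith) (hfgh x d)
    exact lt_of_pow_lt_pow_left₀ 2 (hh0 x) this
  · have h1 : {x | s < f x} = ∅ := by ext x; simpa using (hf1 x).trans hs1
    have h2 : {x | s < g x} = ∅ := by ext x; simpa using (hg1 x).trans hs1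
    simp [h1, h2]

lemma lintegral_ofReal_mul_le_of_bounded {f g h : ℝ → ℝ} (hf : Measurable f) (hg : Measurable g)
    (hh : Measurable h) (hf0 : ∀ x, 0 ≤ f x) (hg0 : ∀ x, 0 ≤ g x) (hh0 : ∀ x, 0 ≤ h x)
    (hfb : BddAbove (range f)) (hgb : BddAbove (range g))
    (hfgh : ∀ x d, f (x + d) * g (x - d) ≤ h x ^ 2) :
    (∫⁻ x, ENNReal.ofReal (f x)) * (∫⁻ x, ENNReal.ofReal (g x)) ≤
      (∫⁻ x, ENNReal.ofReal (h x)) ^ 2 := by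
  have key : ∀ u : ℝ → ℝ, (∀ x, 0 ≤ u x) → BddAbove (range u) →
      (∫⁻ x, ENNReal.ofReal (u x)) = 0 ∨ ∃ M > 0, (∀ x, u x ≤ M) ∧ ∀ s < M, ∃ x, s < u x := by
    intro u hu hb
    by_cases h0 : ∀ x, u x ≤ 0
    · left
      simp [fun x => ENNReal.ofReal_of_nonpos (h0 x)]
    · push Not at h0
      obtain ⟨x, hx⟩ := h0
      exact .inr ⟨⨆ x, u x, hx.trans_le (le_ciSup hb x), le_ciSup hb,
        fun s hs => exists_lt_of_lt_ciSup hs⟩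
  rcases key f hf0 hfb with hz | ⟨M, hM, hfM, hfs⟩
  · simp [hz]
  rcases key g hg0 hgb with hz | ⟨N, hN, hgN, hgs⟩
  · simp [hz]
  have hMN : 0 < M * N := by positivity
  have hsq : √(M * N) ^ 2 = M * N := Real.sq_sqrt hMN.le
  have hsq0 : 0 < √(M * N) := Real.sqrt_pos.2 hMN
  have main := lintegral_ofReal_mul_le_of_normalized (f := fun x => M⁻¹ * f x)
    (g := fun x => N⁻¹ * g x) (h := fun x => (√(M * N))⁻¹ * h x) (hf.const_mul _)
    (hg.const_mul _) (hh.const_mul _) (fun x => mul_nonneg (by positivity) (hf0 x))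
    (fun x => mul_nonneg (by positivity) (hg0 x)) (fun x => mul_nonneg (by positivity) (hh0 x))
    (fun x => by rw [inv_mul_le_iff₀ hM, mul_one]; exact hfM x)
    (fun x => by rw [inv_mul_le_iff₀ hN, mul_one]; exact hgN x)
    (fun s hs => by
      obtain ⟨x, hx⟩ := hfs (M * s) (by nlinarith)
      exact ⟨x, by rwa [lt_inv_mul_iff₀ hM]⟩)
    (fun s hs => by
      obtain ⟨x, hx⟩ := hgs (N * s) (by nlinarith)
      exact ⟨x, by rwa [lt_inv_mul_iff₀ hN]⟩)
    (fun x d => by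
      rw [mul_pow, inv_pow, hsq, mul_inv]
      have := mul_le_mul_of_nonneg_left (hfgh x d) (by positivity : 0 ≤ M⁻¹ * N⁻¹)
      linarith)
  have scale : ∀ (a : ℝ) (u : ℝ → ℝ), 0 < a → (∫⁻ x, ENNReal.ofReal (u x)) =
      ENNReal.ofReal a * ∫⁻ x, ENNReal.ofReal (a⁻¹ * u x) := by
    intro a u ha
    rw [← lintegral_const_mul' _ _ ENNReal.ofReal_ne_top]
    refine lintegral_congr fun x => ?_
    rw [← ENNReal.ofReal_mul ha.le, mul_inv_cancel_left₀ ha.ne']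
  rw [scale M f hM, scale N g hN, scale _ h hsq0, mul_pow, ← ENNReal.ofReal_pow hsq0.le, hsq,
    mul_mul_mul_comm, ← ENNReal.ofReal_mul hM.le]
  gcongr

lemma prekopaLeindler_real : PrekopaLeindler (volume : Measure ℝ) := by
  intro f g h hf hg hh hfgh
  have trunc : ∀ n : ℕ, (∫⁻ x, min (f x) n) * (∫⁻ x, min (g x) n) ≤ (∫⁻ x, h x) ^ 2 := by
    intro n
    have hne : ∀ a : ℝ≥0∞, min a n ≠ ⊤ := fun a =>
      ne_top_of_le_ne_top (ENNReal.natCast_ne_top n) (min_le_right _ _)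
    have hbd : ∀ u : ℝ → ℝ≥0∞, BddAbove (range fun x => (min (u x) n).toReal) := by
      intro u
      refine ⟨n, ?_⟩
      rintro _ ⟨x, rfl⟩
      simpa using ENNReal.toReal_mono (ENNReal.natCast_ne_top n) (min_le_right (u x) n)
    have := lintegral_ofReal_mul_le_of_bounded (f := fun x => (min (f x) n).toReal)
      (g := fun x => (min (g x) n).toReal) (h := fun x => (min (h x) n).toReal)
      (hf.min measurable_const).ennreal_toReal (hg.min measurable_const).ennreal_toReal
      (hh.min measurable_const).ennreal_toReal (fun _ => ENNReal.toReal_nonneg)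
      (fun _ => ENNReal.toReal_nonneg) (fun _ => ENNReal.toReal_nonneg) (hbd f) (hbd g) ?_
    · simp only [ENNReal.ofReal_toReal (hne _)] at this
      refine this.trans ?_
      gcongr
      exact min_le_left _ _
    · intro x d
      rw [← ENNReal.toReal_mul, ← ENNReal.toReal_pow]
      refine ENNReal.toReal_mono (ENNReal.pow_ne_top (hne _)) ?_
      rcases le_total (h x) n with hx | hx
      · rw [min_eq_left hx]
        exact le_trans (by gcongr <;> exact min_le_left _ _) (hfgh x d)
      · rw [min_eq_right hx, sq]
        gcongr <;> exact min_le_right _ _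
  have hsup : ∀ u : ℝ → ℝ≥0∞, Measurable u →
      (∫⁻ x, u x) = ⨆ n : ℕ, ∫⁻ x, min (u x) n := by
    intro u hu
    rw [← lintegral_iSup (fun n => hu.min measurable_const)
      (fun m n hmn x => min_le_min_left _ (by exact_mod_cast hmn))]
    refine lintegral_congr fun x => ?_
    rw [← inf_iSup_eq, ENNReal.iSup_natCast, inf_top_eq]
  rw [hsup f hf, hsup g hg, ENNReal.iSup_mul]
  refine iSup_le fun m => ?_
  rw [ENNReal.mul_iSup]
  refine iSup_le fun n => le_trans ?_ (trunc (max m n))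
  gcongr
  · exact le_max_left _ _
  · exact le_max_right _ _

lemma PrekopaLeindler.prod {α β : Type*} [AddGroup α] [MeasurableSpace α] [AddGroup β]
    [MeasurableSpace β] {μ : Measure α} {ν : Measure β} [SFinite ν] (hμ : PrekopaLeindler μ)
    (hν : PrekopaLeindler ν) : PrekopaLeindler (μ.prod ν) := by
  intro f g h hf hg hh hfgh
  rw [lintegral_prod _ hf.aemeasurable, lintegral_prod _ hg.aemeasurable,
    lintegral_prod _ hh.aemeasurable]
  refine hμ _ _ _ hf.lintegral_prod_right' hg.lintegral_prod_right' hh.lintegral_prod_right'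
    fun x d => ?_
  exact hν _ _ _ (hf.comp measurable_prodMk_left) (hg.comp measurable_prodMk_left)
    (hh.comp measurable_prodMk_left) fun y e => hfgh (x, y) (d, e)

lemma PrekopaLeindler.of_measurePreserving {α β : Type*} [AddGroup α] [MeasurableSpace α]
    [AddGroup β] [MeasurableSpace β] {μ : Measure α} {ν : Measure β} (hμ : PrekopaLeindler μ)
    (e : α → β) (he : MeasurePreserving e μ ν) (hadd : ∀ x y, e (x + y) = e x + e y) :
    PrekopaLeindler ν := by
  intro f g h hf hg hh hfgh
  rw [← he.lintegral_comp hf, ← he.lintegral_comp hg, ← he.lintegral_comp hh]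
  refine hμ _ _ _ (hf.comp he.measurable) (hg.comp he.measurable) (hh.comp he.measurable)
    fun x d => ?_
  have hsub : e (x - d) = e x - e d := map_sub (AddMonoidHom.mk' e hadd) x d
  simpa only [hadd, hsub] using hfgh (e x) (e d)

lemma prekopaLeindler_pi (n : ℕ) : PrekopaLeindler (volume : Measure (Fin n → ℝ)) := by
  induction n with
  | zero =>
    intro f g h _ _ _ hfgh
    have hv : (volume : Measure (Fin 0 → ℝ)) univ = 1 := by
      rw [volume_pi, Measure.pi_empty_univ]
    simp only [lintegral_unique, hv, mul_one]
    convert hfgh default 0 using 3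
  | succ n ih =>
    exact (prekopaLeindler_real.prod ih).of_measurePreserving _
      (volume_preserving_piFinSuccAbove (fun _ : Fin (n + 1) => ℝ) 0).symm fun x y => by
        ext i
        refine Fin.cases ?_ (fun j => ?_) i <;> simp [MeasurableEquiv.piFinSuccAbove]

/-- The Prékopa–Leindler inequality for Lebesgue measure on a Euclidean space. -/
lemma prekopaLeindler_volume {E : Type*} [NormedAddCommGroup E] [InnerProductSpace ℝ E]
    [FiniteDimensional ℝ E] [MeasurableSpace E] [BorelSpace E] :
    PrekopaLeindler (volume : Measure E) :=
  ((prekopaLeindler_pi _).of_measurePreserving _ (PiLp.volume_preserving_toLp _)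
    fun _ _ => rfl).of_measurePreserving _ (stdOrthonormalBasis ℝ E).measurePreserving_repr_symm
      fun _ _ => map_add _ _ _

lemma PrekopaLeindler.integral_mul_le {α : Type*} [AddGroup α] [MeasurableSpace α] {μ : Measure α}
    (hμ : PrekopaLeindler μ) {f g h : α → ℝ} (hf : Measurable f) (hg : Measurable g)
    (hh : Measurable h) (hfi : Integrable f μ) (hgi : Integrable g μ) (hhi : Integrable h μ)
    (hf0 : ∀ x, 0 ≤ f x) (hg0 : ∀ x, 0 ≤ g x) (hh0 : ∀ x, 0 ≤ h x)
    (hfgh : ∀ x d, f (x + d) * g (x - d) ≤ h x ^ 2) :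
    (∫ x, f x ∂μ) * (∫ x, g x ∂μ) ≤ (∫ x, h x ∂μ) ^ 2 := by
  have := hμ _ _ _ hf.ennreal_ofReal hg.ennreal_ofReal hh.ennreal_ofReal fun x d => by
    rw [← ENNReal.ofReal_mul (hf0 _), ← ENNReal.ofReal_pow (hh0 _)]
    exact ENNReal.ofReal_le_ofReal (hfgh x d)
  rwa [← ofReal_integral_eq_lintegral_ofReal hfi (.of_forall hf0),
    ← ofReal_integral_eq_lintegral_ofReal hgi (.of_forall hg0),
    ← ofReal_integral_eq_lintegral_ofReal hhi (.of_forall hh0),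
    ← ENNReal.ofReal_mul (integral_nonneg hf0), ← ENNReal.ofReal_pow (integral_nonneg hh0),
    ENNReal.ofReal_le_ofReal_iff (by positivity)] at this

/-- A convex function on a finite-dimensional space decays at most linearly. -/
lemma ConvexOn.exists_sub_mul_norm_le {E : Type*} [NormedAddCommGroup E] [NormedSpace ℝ E]
    [FiniteDimensional ℝ E] {W : E → ℝ} (hW : ConvexOn ℝ univ W) :
    ∃ a b : ℝ, ∀ x, a - b * ‖x‖ ≤ W x := by
  have hcont : Continuous W := continuousOn_univ.1 (hW.continuousOn isOpen_univ)
  have : ProperSpace E := FiniteDimensional.proper ℝ E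
  obtain ⟨z, -, hz⟩ := (isCompact_closedBall (0 : E) 1).exists_isMinOn ⟨0, by simp⟩
    hcont.continuousOn
  have hz' : ∀ u : E, ‖u‖ ≤ 1 → W z ≤ W u := fun u hu => hz (by simpa using hu)
  have h0 := hz' 0 (by simp)
  refine ⟨W z, W 0 - W z, fun x => ?_⟩
  rcases le_or_gt ‖x‖ 1 with hx | hx
  · nlinarith [hz' x hx, norm_nonneg x]
  · have hr : 0 < ‖x‖ := by linarith
    have h1 := hz' (‖x‖⁻¹ • x) (by rw [norm_smul, norm_inv, norm_norm, inv_mul_cancel₀ hr.ne'])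
    have h2 := hW.2 (mem_univ (0 : E)) (mem_univ x) (sub_nonneg.2 (inv_le_one_of_one_le₀ hx.le))
      (inv_nonneg.2 hr.le) (by ring)
    simp only [smul_zero, zero_add, smul_eq_mul] at h2
    have h3 := mul_le_mul_of_nonneg_left (h1.trans h2) hr.le
    have h4 : ‖x‖ * ((1 - ‖x‖⁻¹) * W 0 + ‖x‖⁻¹ * W x) = (‖x‖ - 1) * W 0 + W x := by
      field_simp
    linarith

lemma integrable_exp_neg_mul_norm_sq {E : Type*} [NormedAddCommGroup E] [InnerProductSpace ℝ E]
    [FiniteDimensional ℝ E] [MeasurableSpace E] [BorelSpace E] {b : ℝ} (hb : 0 < b) :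
    Integrable fun x : E => Real.exp (-b * ‖x‖ ^ 2) := by
  have := (GaussianFourier.integrable_cexp_neg_mul_sq_norm_add (b := (b : ℂ)) (V := E)
    (by simpa using hb) 0 0).norm
  refine this.congr (.of_forall fun x => ?_)
  simp [Complex.norm_exp, ← Complex.ofReal_pow]

/-- A density `exp (-U)` with `U` strongly convex has exponential moments of all orders. -/
lemma integrable_exp_neg_smul {E G : Type*} [NormedAddCommGroup E] [InnerProductSpace ℝ E]
    [FiniteDimensional ℝ E] [MeasurableSpace E] [BorelSpace E] [NormedAddCommGroup G]
    [NormedSpace ℝ G] {U : E → ℝ} {c : ℝ} (hc : 0 < c)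
    (hU : ConvexOn ℝ univ fun x => U x - c / 2 * ‖x‖ ^ 2) (hUc : Continuous U)
    {φ : E → G} (hφ : Continuous φ) {A B : ℝ} (hA : ∀ x, ‖φ x‖ ≤ A * Real.exp (B * ‖x‖)) :
    Integrable fun x => Real.exp (-U x) • φ x := by
  obtain ⟨a, b, hab⟩ := hU.exists_sub_mul_norm_le
  have hA0 : 0 ≤ A := by simpa using (norm_nonneg _).trans (hA 0)
  refine ((integrable_exp_neg_mul_norm_sq (E := E) (b := c / 4) (by positivity)).const_mul
    (A * Real.exp (-a + (b + B) ^ 2 / c))).mono'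
    (by fun_prop : Continuous _).aestronglyMeasurable (.of_forall fun x => ?_)
  rw [norm_smul, Real.norm_eq_abs, Real.abs_exp]
  calc Real.exp (-U x) * ‖φ x‖ ≤ Real.exp (-U x) * (A * Real.exp (B * ‖x‖)) := by
        gcongr; exact hA x
    _ = A * Real.exp (-U x + B * ‖x‖) := by rw [Real.exp_add]; ring
    _ ≤ A * Real.exp (-a + (b + B) ^ 2 / c + -(c / 4) * ‖x‖ ^ 2) := by
        refine mul_le_mul_of_nonneg_left (Real.exp_le_exp.2 ?_) hA0
        have h1 := hab x
        have h2 : 0 ≤ ((b + B) - c / 2 * ‖x‖) ^ 2 / c := by positivity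
        have h3 : ((b + B) - c / 2 * ‖x‖) ^ 2 / c =
          (b + B) ^ 2 / c - (b + B) * ‖x‖ + c / 4 * ‖x‖ ^ 2 := by field_simp; ring
        linarith
    _ = _ := by rw [Real.exp_add]; ring

lemma ConvexOn.two_mul_add_le {E F : Type*} [NormedAddCommGroup E] [InnerProductSpace ℝ E]
    [NormedAddCommGroup F] [InnerProductSpace ℝ F] {V : E × F → ℝ} {c : ℝ}
    (hV : ConvexOn ℝ univ (fun p : E × F => V p - c / 2 * (‖p.1‖ ^ 2 + ‖p.2‖ ^ 2)))
    (x d : E) (y k : F) :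
    2 * V (x, y) + c * (‖d‖ ^ 2 + ‖k‖ ^ 2) ≤ V (x + d, y + k) + V (x - d, y - k) := by
  have h := hV.2 (mem_univ (x + d, y + k)) (mem_univ (x - d, y - k))
    (by norm_num : (0 : ℝ) ≤ 1 / 2) (by norm_num : (0 : ℝ) ≤ 1 / 2) (by norm_num)
  have hmid : (1 / 2 : ℝ) • (x + d, y + k) + (1 / 2 : ℝ) • (x - d, y - k) = (x, y) := by
    ext <;> simp only [Prod.smul_mk, Prod.mk_add_mk] <;> module
  rw [hmid] at h
  simp only [smul_eq_mul] at h
  have h1 := parallelogram_law_with_norm ℝ x d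
  have h2 := parallelogram_law_with_norm ℝ y k
  linear_combination 2 * h - c / 2 * (h1 + h2)

lemma ConcaveOn.add_le_two_mul {E F : Type*} [NormedAddCommGroup E] [InnerProductSpace ℝ E]
    [NormedAddCommGroup F] [InnerProductSpace ℝ F] {V : E × F → ℝ} {C : ℝ}
    (hV : ConcaveOn ℝ univ (fun p : E × F => V p - C / 2 * (‖p.1‖ ^ 2 + ‖p.2‖ ^ 2)))
    (x d : E) (y k : F) :
    V (x + d, y + k) + V (x - d, y - k) ≤ 2 * V (x, y) + C * (‖d‖ ^ 2 + ‖k‖ ^ 2) := by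
  have h : ConvexOn ℝ univ (fun p : E × F => (-V) p - (-C) / 2 * (‖p.1‖ ^ 2 + ‖p.2‖ ^ 2)) := by
    refine hV.neg.congr fun p _ => ?_
    simp only [Pi.neg_apply]
    ring
  have := h.two_mul_add_le x d y k
  simp only [Pi.neg_apply] at this
  linarith

lemma ConvexOn.slice {E F : Type*} [NormedAddCommGroup E] [InnerProductSpace ℝ E]
    [NormedAddCommGroup F] [InnerProductSpace ℝ F] {V : E × F → ℝ} {c : ℝ}
    (hV : ConvexOn ℝ univ (fun p : E × F => V p - c / 2 * (‖p.1‖ ^ 2 + ‖p.2‖ ^ 2))) (y : F) :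
    ConvexOn ℝ univ (fun x : E => V (x, y) - c / 2 * ‖x‖ ^ 2) := by
  refine ⟨convex_univ, fun x _ x' _ a b ha hb hab => ?_⟩
  have h := hV.2 (mem_univ (x, y)) (mem_univ (x', y)) ha hb hab
  have hy : a • y + b • y = y := by rw [← add_smul, hab, one_smul]
  simp only [Prod.smul_mk, Prod.mk_add_mk, smul_eq_mul, hy] at h ⊢
  linear_combination h - c / 2 * ‖y‖ ^ 2 * hab

/-- Jensen's inequality for the mean of `φ` under the density proportional to `exp (-U)`. -/
lemma integral_mul_exp_mean_le {α : Type*} [MeasurableSpace α] {μ : Measure α} {U φ : α → ℝ}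
    (hU : Integrable (fun x => Real.exp (-U x)) μ)
    (hφ : Integrable (fun x => Real.exp (-U x) * φ x) μ)
    (hexp : Integrable (fun x => Real.exp (-U x) * Real.exp (φ x)) μ)
    (hpos : 0 < ∫ x, Real.exp (-U x) ∂μ) :
    (∫ x, Real.exp (-U x) ∂μ) *
        Real.exp ((∫ x, Real.exp (-U x) ∂μ)⁻¹ * ∫ x, Real.exp (-U x) * φ x ∂μ) ≤
      ∫ x, Real.exp (-U x) * Real.exp (φ x) ∂μ := by
  set Z := ∫ x, Real.exp (-U x) ∂μ
  set m := Z⁻¹ * ∫ x, Real.exp (-U x) * φ x ∂μ with hm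
  have hmZ : ∫ x, Real.exp (-U x) * φ x ∂μ = Z * m := by rw [hm, mul_inv_cancel_left₀ hpos.ne']
  have h1 : ∫ x, Real.exp m * (Real.exp (-U x) * φ x + (1 - m) * Real.exp (-U x)) ∂μ =
      Z * Real.exp m := by
    rw [integral_const_mul, integral_add hφ (hU.const_mul _), integral_const_mul, hmZ]
    ring
  rw [← h1]
  refine integral_mono ((hφ.add (hU.const_mul _)).const_mul _) hexp fun x => ?_
  have h2 := Real.add_one_le_exp (φ x - m)
  have h3 : Real.exp (φ x) = Real.exp m * Real.exp (φ x - m) := by rw [← Real.exp_add]; congr 1; ring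
  calc Real.exp m * (Real.exp (-U x) * φ x + (1 - m) * Real.exp (-U x))
      = Real.exp (-U x) * (Real.exp m * (φ x - m + 1)) := by ring
    _ ≤ Real.exp (-U x) * Real.exp (φ x) := by rw [h3]; gcongr

lemma sq_integral_le_mul_integral {α : Type*} [MeasurableSpace α] {μ : Measure α} {f g h : α → ℝ}
    (hf : Integrable f μ) (hg : Integrable g μ) (hh : Integrable h μ) (hf0 : ∀ x, 0 ≤ f x)
    (hg0 : ∀ x, 0 ≤ g x) (hh0 : ∀ x, 0 ≤ h x) (hfp : 0 < ∫ x, f x ∂μ) (hgp : 0 < ∫ x, g x ∂μ)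
    (hfgh : ∀ x, h x ^ 2 ≤ f x * g x) :
    (∫ x, h x ∂μ) ^ 2 ≤ (∫ x, f x ∂μ) * ∫ x, g x ∂μ := by
  set a := ∫ x, f x ∂μ
  set b := ∫ x, g x ∂μ
  have hs : 0 < √(a * b) := Real.sqrt_pos.2 (by positivity)
  have hsq : √(a * b) ^ 2 = a * b := Real.sq_sqrt (by positivity)
  have key : ∫ x, 2 * √(a * b) * h x ∂μ ≤ ∫ x, (b * f x + a * g x) ∂μ := by
    refine integral_mono (hh.const_mul _) ((hf.const_mul _).add (hg.const_mul _)) fun x => ?_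
    refine (sq_le_sq₀ (mul_nonneg (by positivity) (hh0 x))
      (add_nonneg (mul_nonneg hgp.le (hf0 x)) (mul_nonneg hfp.le (hg0 x)))).1 ?_
    have := mul_le_mul_of_nonneg_left (hfgh x) (by positivity : 0 ≤ 4 * (a * b))
    calc (2 * √(a * b) * h x) ^ 2 = 4 * (a * b) * h x ^ 2 := by rw [mul_pow, mul_pow, hsq]; ring
      _ ≤ 4 * (a * b) * (f x * g x) := this
      _ ≤ (b * f x + a * g x) ^ 2 := by nlinarith [sq_nonneg (b * f x - a * g x)]
  rw [integral_const_mul, integral_add (hf.const_mul _) (hg.const_mul _), integral_const_mul,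
    integral_const_mul] at key
  change 2 * √(a * b) * _ ≤ b * a + a * b at key
  have h1 : ∫ x, h x ∂μ ≤ √(a * b) := by
    refine le_of_mul_le_mul_left ?_ hs
    nlinarith
  calc (∫ x, h x ∂μ) ^ 2 ≤ √(a * b) ^ 2 := by gcongr; exact integral_nonneg hh0
    _ = a * b := hsq

lemma continuous_of_lipschitz_slice {E F G : Type*} [NormedAddCommGroup E]
    [NormedAddCommGroup F] [NormedAddCommGroup G] {M : ℝ} {φ : E × F → G}
    (hφ : ∀ p q : E × F, ‖φ p - φ q‖ ≤ M * √(‖p.1 - q.1‖ ^ 2 + ‖p.2 - q.2‖ ^ 2)) (y : F) :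
    Continuous fun x => φ (x, y) := by
  have h : LipschitzWith (Real.toNNReal M) fun x => φ (x, y) := by
    refine LipschitzWith.of_dist_le' fun x x' => ?_
    simpa [dist_eq_norm] using hφ (x, y) (x', y)
  exact h.continuous

lemma norm_le_of_lipschitz_slice {E F G : Type*} [NormedAddCommGroup E]
    [NormedAddCommGroup F] [NormedAddCommGroup G] {M : ℝ} {φ : E × F → G}
    (hφ : ∀ p q : E × F, ‖φ p - φ q‖ ≤ M * √(‖p.1 - q.1‖ ^ 2 + ‖p.2 - q.2‖ ^ 2)) (x : E) (y : F) :
    ‖φ (x, y)‖ ≤ ‖φ (0, y)‖ + M * ‖x‖ := by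
  have h1 : ‖φ (x, y) - φ (0, y)‖ ≤ M * ‖x‖ := by simpa using hφ (x, y) (0, y)
  have h2 := norm_sub_norm_le (φ (x, y)) (φ (0, y))
  linarith

lemma continuous_slice {E F : Type*} [NormedAddCommGroup E] [InnerProductSpace ℝ E]
    [FiniteDimensional ℝ E] [NormedAddCommGroup F] [InnerProductSpace ℝ F] {V : E × F → ℝ} {c : ℝ}
    (hV : ConvexOn ℝ univ (fun p : E × F => V p - c / 2 * (‖p.1‖ ^ 2 + ‖p.2‖ ^ 2))) (y : F) :
    Continuous fun x => V (x, y) := by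
  have h := continuousOn_univ.1 ((hV.slice y).continuousOn isOpen_univ)
  have h2 : Continuous fun x : E => V (x, y) - c / 2 * ‖x‖ ^ 2 + c / 2 * ‖x‖ ^ 2 := by fun_prop
  simpa using h2

section Gibbs

variable {E F G : Type*} [NormedAddCommGroup E] [InnerProductSpace ℝ E] [FiniteDimensional ℝ E]
  [MeasurableSpace E] [BorelSpace E] [NormedAddCommGroup F] [InnerProductSpace ℝ F]
  [NormedAddCommGroup G] [NormedSpace ℝ G] {c C M : ℝ} {V : E × F → ℝ}

lemma integrable_gibbs (hc : 0 < c)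
    (hV : ConvexOn ℝ univ (fun p : E × F => V p - c / 2 * (‖p.1‖ ^ 2 + ‖p.2‖ ^ 2))) (y : F) :
    Integrable fun x => Real.exp (-V (x, y)) := by
  simpa using integrable_exp_neg_smul hc (hV.slice y) (continuous_slice hV y)
    (φ := fun _ => (1 : ℝ)) continuous_const (A := 1) (B := 0) (by simp)

lemma integral_gibbs_pos (hc : 0 < c)
    (hV : ConvexOn ℝ univ (fun p : E × F => V p - c / 2 * (‖p.1‖ ^ 2 + ‖p.2‖ ^ 2))) (y : F) :
    0 < ∫ x, Real.exp (-V (x, y)) :=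
  integral_exp_pos (integrable_gibbs hc hV y)

lemma integrable_gibbs_smul (hc : 0 < c)
    (hV : ConvexOn ℝ univ (fun p : E × F => V p - c / 2 * (‖p.1‖ ^ 2 + ‖p.2‖ ^ 2)))
    (hM : 0 ≤ M) {φ : E × F → G}
    (hφ : ∀ p q : E × F, ‖φ p - φ q‖ ≤ M * √(‖p.1 - q.1‖ ^ 2 + ‖p.2 - q.2‖ ^ 2)) (y : F) :
    Integrable fun x => Real.exp (-V (x, y)) • φ (x, y) := by
  refine integrable_exp_neg_smul hc (hV.slice y) (continuous_slice hV y)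
    (continuous_of_lipschitz_slice hφ y) (A := ‖φ (0, y)‖ + M) (B := 1) fun x => ?_
  have h1 := norm_le_of_lipschitz_slice hφ x y
  have h2 := Real.add_one_le_exp ‖x‖
  have h3 := Real.one_le_exp (norm_nonneg x)
  rw [one_mul]
  nlinarith [norm_nonneg (φ (0, y))]

lemma integrable_gibbs_mul_exp (hc : 0 < c)
    (hV : ConvexOn ℝ univ (fun p : E × F => V p - c / 2 * (‖p.1‖ ^ 2 + ‖p.2‖ ^ 2)))
    {φ : E × F → ℝ}
    (hφ : ∀ p q : E × F, ‖φ p - φ q‖ ≤ M * √(‖p.1 - q.1‖ ^ 2 + ‖p.2 - q.2‖ ^ 2)) (y : F) :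
    Integrable fun x => Real.exp (-V (x, y)) * Real.exp (φ (x, y)) := by
  refine integrable_exp_neg_smul hc (hV.slice y) (continuous_slice hV y)
    (continuous_of_lipschitz_slice hφ y).rexp (A := Real.exp ‖φ (0, y)‖) (B := M) fun x => ?_
  rw [Real.norm_eq_abs, Real.abs_exp, ← Real.exp_add]
  exact Real.exp_le_exp.2 ((le_abs_self _).trans (norm_le_of_lipschitz_slice hφ x y))

/-- The Gibbs mean of `φ(·, y)` changes by at most `M ^ 2 / c + C * ‖k‖ ^ 2` between `y - k` and
`y + k`. -/
lemma gibbs_mean_sub_le (hc : 0 < c)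
    (hconv : ConvexOn ℝ univ (fun p : E × F => V p - c / 2 * (‖p.1‖ ^ 2 + ‖p.2‖ ^ 2)))
    (hconc : ConcaveOn ℝ univ (fun p : E × F => V p - C / 2 * (‖p.1‖ ^ 2 + ‖p.2‖ ^ 2)))
    (hM : 0 ≤ M) {φ : E × F → ℝ}
    (hφ : ∀ p q : E × F, ‖φ p - φ q‖ ≤ M * √(‖p.1 - q.1‖ ^ 2 + ‖p.2 - q.2‖ ^ 2)) (y k : F) :
    (∫ x, Real.exp (-V (x, y + k)))⁻¹ * (∫ x, Real.exp (-V (x, y + k)) * φ (x, y + k)) -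
        (∫ x, Real.exp (-V (x, y - k)))⁻¹ * (∫ x, Real.exp (-V (x, y - k)) * φ (x, y - k)) ≤
      M ^ 2 / c + C * ‖k‖ ^ 2 := by
  have hψ : ∀ p q : E × F, ‖(-φ) p - (-φ) q‖ ≤ M * √(‖p.1 - q.1‖ ^ 2 + ‖p.2 - q.2‖ ^ 2) := by
    intro p q
    have := hφ p q
    rwa [Pi.neg_apply, Pi.neg_apply, neg_sub_neg, norm_sub_rev]
  have hJp := integral_mul_exp_mean_le (integrable_gibbs hc hconv (y + k))
    (integrable_gibbs_smul hc hconv hM hφ (y + k)) (integrable_gibbs_mul_exp hc hconv hφ (y + k))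
    (integral_gibbs_pos hc hconv (y + k))
  have hJm := integral_mul_exp_mean_le (integrable_gibbs hc hconv (y - k))
    (integrable_gibbs_smul hc hconv hM hψ (y - k)) (integrable_gibbs_mul_exp hc hconv hψ (y - k))
    (integral_gibbs_pos hc hconv (y - k))
  have hV := continuous_slice hconv
  have hφc := continuous_of_lipschitz_slice hφ
  have hPL := prekopaLeindler_volume.integral_mul_le
    (f := fun x => Real.exp (-V (x, y + k)) * Real.exp (φ (x, y + k)))
    (g := fun x => Real.exp (-V (x, y - k)) * Real.exp ((-φ) (x, y - k)))
    (h := fun x => Real.exp (M ^ 2 / c / 2) * Real.exp (-V (x, y)))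
    ((hV _).neg.rexp.mul (hφc _).rexp).measurable ((hV _).neg.rexp.mul (hφc _).neg.rexp).measurable
    ((hV _).neg.rexp.const_mul _).measurable (integrable_gibbs_mul_exp hc hconv hφ _)
    (integrable_gibbs_mul_exp hc hconv hψ _) ((integrable_gibbs hc hconv y).const_mul _)
    (fun _ => by positivity) (fun _ => by positivity) (fun _ => by positivity) (fun x d => by
      rw [← Real.exp_add, ← Real.exp_add, ← Real.exp_add, ← Real.exp_add, ← Real.exp_nat_mul,
        Real.exp_le_exp, Pi.neg_apply]
      have h1 := hconv.two_mul_add_le x d y k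
      have h2 := (le_abs_self _).trans (hφ (x + d, y + k) (x - d, y - k))
      have h3 : ‖x + d - (x - d)‖ ^ 2 + ‖y + k - (y - k)‖ ^ 2 =
          2 ^ 2 * (‖d‖ ^ 2 + ‖k‖ ^ 2) := by
        rw [show x + d - (x - d) = (2 : ℝ) • d by module,
          show y + k - (y - k) = (2 : ℝ) • k by module, norm_smul, norm_smul]
        norm_num
        ring
      simp only [h3] at h2
      rw [Real.sqrt_mul (by norm_num), Real.sqrt_sq (by norm_num)] at h2
      have h4 : √(‖d‖ ^ 2 + ‖k‖ ^ 2) ^ 2 = ‖d‖ ^ 2 + ‖k‖ ^ 2 := Real.sq_sqrt (by positivity)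
      set r := √(‖d‖ ^ 2 + ‖k‖ ^ 2)
      have h5 : 0 ≤ (M - c * r) ^ 2 / c := by positivity
      have h6 : (M - c * r) ^ 2 / c = M ^ 2 / c - M * (2 * r) + c * r ^ 2 := by field_simp; ring
      rw [← h4] at h1
      push_cast
      linarith)
  have hCS := sq_integral_le_mul_integral
    (f := fun x => Real.exp (-V (x, y + k))) (g := fun x => Real.exp (-V (x, y - k)))
    (h := fun x => Real.exp (-(C * ‖k‖ ^ 2 / 2)) * Real.exp (-V (x, y)))
    (integrable_gibbs hc hconv _) (integrable_gibbs hc hconv _)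
    ((integrable_gibbs hc hconv y).const_mul _) (fun _ => by positivity) (fun _ => by positivity)
    (fun _ => by positivity) (integral_gibbs_pos hc hconv _) (integral_gibbs_pos hc hconv _)
    (fun x => by
      rw [← Real.exp_add, ← Real.exp_add, ← Real.exp_nat_mul, Real.exp_le_exp]
      have h1 := hconc.add_le_two_mul x 0 y k
      simp only [add_zero, sub_zero, norm_zero] at h1
      push_cast
      linarith)
  have hp := integral_gibbs_pos hc hconv (y + k)
  have hm := integral_gibbs_pos hc hconv (y - k)
  have hz := integral_gibbs_pos hc hconv y
  simp only [Pi.neg_apply, mul_neg, integral_neg, integral_const_mul, mul_pow,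
    ← Real.exp_nat_mul] at hJp hJm hPL hCS
  have key := (mul_le_mul hJp hJm (by positivity) (by positivity)).trans hPL
  set Zp := ∫ x, Real.exp (-V (x, y + k))
  set Zm := ∫ x, Real.exp (-V (x, y - k))
  set Z := ∫ x, Real.exp (-V (x, y))
  set mp := Zp⁻¹ * ∫ x, Real.exp (-V (x, y + k)) * φ (x, y + k)
  set mm := Zm⁻¹ * ∫ x, Real.exp (-V (x, y - k)) * φ (x, y - k)
  have h1 : Zp * Zm * Real.exp (mp - mm) ≤ Zp * Zm * Real.exp (M ^ 2 / c + C * ‖k‖ ^ 2) := by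
    calc Zp * Zm * Real.exp (mp - mm) = Zp * Real.exp mp * (Zm * Real.exp (-mm)) := by
          rw [sub_eq_add_neg, Real.exp_add]; ring
      _ ≤ Real.exp ((2 : ℕ) * (M ^ 2 / c / 2)) * Z ^ 2 := key
      _ = Real.exp (M ^ 2 / c + C * ‖k‖ ^ 2) *
          (Real.exp (-((2 : ℕ) * (C * ‖k‖ ^ 2 / 2))) * Z ^ 2) := by
          rw [← mul_assoc, ← Real.exp_add]
          congr 2
          push_cast
          ring
      _ ≤ Real.exp (M ^ 2 / c + C * ‖k‖ ^ 2) * (Zp * Zm) :=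
          mul_le_mul_of_nonneg_left hCS (Real.exp_pos _).le
      _ = _ := by ring
  exact Real.exp_le_exp.1 (le_of_mul_le_mul_left h1 (by positivity))

/-- The Gibbs mean of a real Lipschitz function is Lipschitz. -/
lemma gibbs_mean_sub_le_mul_norm (hc : 0 < c) (hC : 0 ≤ C)
    (hconv : ConvexOn ℝ univ (fun p : E × F => V p - c / 2 * (‖p.1‖ ^ 2 + ‖p.2‖ ^ 2)))
    (hconc : ConcaveOn ℝ univ (fun p : E × F => V p - C / 2 * (‖p.1‖ ^ 2 + ‖p.2‖ ^ 2)))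
    (hM : 0 ≤ M) {φ : E × F → ℝ}
    (hφ : ∀ p q : E × F, ‖φ p - φ q‖ ≤ M * √(‖p.1 - q.1‖ ^ 2 + ‖p.2 - q.2‖ ^ 2)) (y y' : F) :
    (∫ x, Real.exp (-V (x, y)))⁻¹ * (∫ x, Real.exp (-V (x, y)) * φ (x, y)) -
        (∫ x, Real.exp (-V (x, y')))⁻¹ * (∫ x, Real.exp (-V (x, y')) * φ (x, y')) ≤
      (1 + C / c) * M * ‖y - y'‖ := by
  rcases eq_or_ne y y' with rfl | hne
  · simp
  have hn : 0 < ‖y - y'‖ := norm_sub_pos_iff.2 hne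
  set K := (1 + C / c) * ‖y - y'‖ with hK
  have hK0 : 0 < K := by positivity
  rw [mul_right_comm, ← hK]
  refine le_of_forall_pos_le_add fun ε hε => ?_
  obtain ⟨N, hMN, hN, hNε⟩ : ∃ N, M ≤ N ∧ 0 < N ∧ K * N ≤ K * M + ε :=
    ⟨M + ε / K, by have := div_pos hε hK0; linarith, by positivity, by field_simp; rfl⟩
  refine le_trans ?_ hNε
  set t := c * ‖y - y'‖ / N with ht
  have ht0 : 0 < t := by positivity
  have h := gibbs_mean_sub_le hc hconv hconc (φ := fun p => t * φ p) (M := t * N) (by positivity)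
    (fun p q => by
      rw [← mul_sub, norm_mul, Real.norm_of_nonneg ht0.le, mul_assoc]
      gcongr
      exact (hφ p q).trans (by gcongr)) ((1 / 2 : ℝ) • (y + y')) ((1 / 2 : ℝ) • (y - y'))
  rw [show (1 / 2 : ℝ) • (y + y') + (1 / 2 : ℝ) • (y - y') = y by module,
    show (1 / 2 : ℝ) • (y + y') - (1 / 2 : ℝ) • (y - y') = y' by module, norm_smul] at h
  simp only [mul_left_comm _ t, integral_const_mul, ← mul_sub] at h
  refine le_of_mul_le_mul_left (h.trans ?_) ht0
  have h1 : (t * N) ^ 2 / c + C * ‖y - y'‖ ^ 2 = t * (K * N) := by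
    rw [hK, ht]; field_simp
  rw [← h1, Real.norm_of_nonneg (by norm_num)]
  gcongr
  linarith

end Gibbs


/-- if `V` on `E × F` satisfies `c ≤ HV ≤ C` and `f : E × F → H` is
`L`-Lipschitz for the product norm, then the conditional-expectation function
`g(y) = (∫ f(x,y) e^{-V(x,y)} dx) / (∫ e^{-V(x,y)} dx)` is well-defined and
`(1 + C/c) L`-Lipschitz. -/
theorem stmt11 {E F H : Type*}
    [NormedAddCommGroup E] [InnerProductSpace ℝ E] [FiniteDimensional ℝ E]
    [MeasurableSpace E] [BorelSpace E]
    [NormedAddCommGroup F] [InnerProductSpace ℝ F] [FiniteDimensional ℝ F]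
    [NormedAddCommGroup H] [InnerProductSpace ℝ H] [FiniteDimensional ℝ H]
    (c C : ℝ) (hc : 0 < c) (hcC : c ≤ C) (V : E × F → ℝ)
    (hconv : ConvexOn ℝ univ
      (fun p : E × F => V p - c / 2 * (‖p.1‖ ^ 2 + ‖p.2‖ ^ 2)))
    (hconc : ConcaveOn ℝ univ
      (fun p : E × F => V p - C / 2 * (‖p.1‖ ^ 2 + ‖p.2‖ ^ 2)))
    (f : E × F → H) (L : ℝ) (hL : 0 ≤ L)
    (hf : ∀ p q : E × F,
      ‖f p - f q‖ ≤ L * Real.sqrt (‖p.1 - q.1‖ ^ 2 + ‖p.2 - q.2‖ ^ 2)) :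
    (∀ y : F,
      Integrable (fun x => Real.exp (-V (x, y))) (volume : Measure E) ∧
      Integrable (fun x => Real.exp (-V (x, y)) • f (x, y)) (volume : Measure E) ∧
      0 < ∫ x, Real.exp (-V (x, y))) ∧
    ∀ y y' : F,
      ‖(∫ x, Real.exp (-V (x, y)))⁻¹ • (∫ x, Real.exp (-V (x, y)) • f (x, y)) -
          (∫ x, Real.exp (-V (x, y')))⁻¹ • (∫ x, Real.exp (-V (x, y')) • f (x, y'))‖ ≤
        (1 + C / c) * L * ‖y - y'‖ := by
  refine ⟨fun y => ⟨integrable_gibbs hc hconv y, integrable_gibbs_smul hc hconv hL hf y,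
    integral_gibbs_pos hc hconv y⟩, fun y y' => ?_⟩
  set w := (∫ x, Real.exp (-V (x, y)))⁻¹ • (∫ x, Real.exp (-V (x, y)) • f (x, y)) -
    (∫ x, Real.exp (-V (x, y')))⁻¹ • (∫ x, Real.exp (-V (x, y')) • f (x, y')) with hw
  rcases eq_or_ne w 0 with h0 | h0
  · have := hc.trans_le hcC
    rw [h0, norm_zero]
    positivity
  have hinner : ∀ z, inner ℝ w
      ((∫ x, Real.exp (-V (x, z)))⁻¹ • (∫ x, Real.exp (-V (x, z)) • f (x, z))) =
      (∫ x, Real.exp (-V (x, z)))⁻¹ * ∫ x, Real.exp (-V (x, z)) * inner ℝ w (f (x, z)) := by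
    intro z
    rw [real_inner_smul_right, ← integral_inner (integrable_gibbs_smul hc hconv hL hf z)]
    simp only [real_inner_smul_right]
  have h := gibbs_mean_sub_le_mul_norm hc (hc.le.trans hcC) hconv hconc
    (φ := fun p => inner ℝ w (f p)) (M := ‖w‖ * L) (by positivity) (fun p q => by
      rw [← inner_sub_right, mul_assoc]
      exact (norm_inner_le_norm _ _).trans (by gcongr; exact hf p q)) y y'
  rw [← hinner, ← hinner, ← inner_sub_right, ← hw, real_inner_self_eq_norm_sq] at h
  refine le_of_mul_le_mul_left ?_ (norm_pos_iff.2 h0)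
  linarith
end
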